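/- Let T be a regular s-interval exchange transformation on [ℓ,r) relative to the partition into semi-intervals I_1,…,I_s. Then each exchanged semi-interval I_i = [γ_i, γ_i + λ_i) is admissible for T, and each image J_i = T(I_i) is admissible for T. -/

import Mathlib

open Set MeasureTheory

noncomputable section

/-- Left endpoint `γ i` of the `i`-th exchanged semi-interval. -/
def sepPt {s : ℕ} (l : ℝ) (len : Fin s → ℝ) (i : Fin s) : ℝ :=
  l + ∑ j ∈ Finset.univ.filter (fun j => j < i), len j

/-- Left endpoint `δ` of the image of the `i`-th exchanged semi-interval. -/
def imgPt {s : ℕ} (l : ℝ) (len : Fin s → ℝ) (π : Equiv.Perm (Fin s)) (i : Fin s) : ℝ :=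
  l + ∑ j ∈ Finset.univ.filter (fun j => π j < π i), len j

/-- `T` is the `s`-interval exchange transformation on `[l,r)` with lengths `len`
and permutation `π`, extended by the identity outside `[l,r)`. -/
def IsIET (s : ℕ) (l r : ℝ) (len : Fin s → ℝ) (π : Equiv.Perm (Fin s))
    (T : Equiv.Perm ℝ) : Prop :=
  l < r ∧ (∀ i, 0 < len i) ∧ (∑ i, len i) = r - l ∧
  (∀ z, z ∉ Set.Ico l r → T z = z) ∧
  ∀ i : Fin s, ∀ z ∈ Set.Ico (sepPt l len i) (sepPt l len i + len i),
    T z = z + (imgPt l len π i - sepPt l len i)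

/-- The two-sided orbit `{T^n z : n ∈ ℤ}`. -/
def orbitZ (T : Equiv.Perm ℝ) (z : ℝ) : Set ℝ := {w | ∃ n : ℤ, (T ^ n) z = w}

/-- Regularity (idoc): the orbits of the nonzero separation points are infinite
and pairwise disjoint. -/
def IsRegularIET (s : ℕ) (l : ℝ) (len : Fin s → ℝ) (T : Equiv.Perm ℝ) : Prop :=
  (∀ i : Fin s, (i : ℕ) ≠ 0 → (orbitZ T (sepPt l len i)).Infinite) ∧
  (∀ i j : Fin s, (i : ℕ) ≠ 0 → (j : ℕ) ≠ 0 → i ≠ j →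
    Disjoint (orbitZ T (sepPt l len i)) (orbitZ T (sepPt l len j)))

/-- Minimality: every (two-sided) orbit of a point of `[l,r)` is dense in `[l,r)`. -/
def IsMinimalOn (T : Equiv.Perm ℝ) (l r : ℝ) : Prop :=
  ∀ z ∈ Set.Ico l r, Set.Ico l r ⊆ closure (orbitZ T z)

/-- First return time of `z` in `I` (defined via `sInf`; meaningful when `T` is minimal). -/
def returnTime (T : Equiv.Perm ℝ) (I : Set ℝ) (z : ℝ) : ℕ :=
  sInf {n : ℕ | 0 < n ∧ (T ^ n) z ∈ I}

/-- The transformation induced by `T` on `I` (first-return map). -/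
def inducedMap (T : Equiv.Perm ℝ) (I : Set ℝ) (z : ℝ) : ℝ :=
  (T ^ returnTime T I z) z

/-- The transformation induced by `T` on `[u,v)` is an interval exchange
transformation on `k` intervals with data `(lam, σ)`. -/
def InducedData (T : Equiv.Perm ℝ) (u v : ℝ) (k : ℕ) (lam : Fin k → ℝ)
    (σ : Equiv.Perm (Fin k)) : Prop :=
  ∃ S : Equiv.Perm ℝ, IsIET k u v lam σ S ∧
    ∀ z ∈ Set.Ico u v, S z = inducedMap T (Set.Ico u v) z

/-- The semi-interval `[l,t)` is right admissible for `T`. -/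
def RightAdmissible (s : ℕ) (l r : ℝ) (len : Fin s → ℝ) (T : Equiv.Perm ℝ)
    (t : ℝ) : Prop :=
  l < t ∧ t < r ∧ ∃ (i : Fin s) (k : ℤ), t = (T ^ k) (sepPt l len i) ∧
    (0 < k → ∀ h : ℤ, 0 < h → h < k → t < (T ^ h) (sepPt l len i)) ∧
    (k ≤ 0 → ∀ h : ℤ, k < h → h ≤ 0 → t < (T ^ h) (sepPt l len i))

/-- `ρ⁺_{I,T}(z) = min {n > 0 : T^n z ∈ (u,v)}`. -/
def rhoPlusPt (T : Equiv.Perm ℝ) (u v z : ℝ) : ℕ :=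
  sInf {n : ℕ | 0 < n ∧ (T ^ n) z ∈ Set.Ioo u v}

/-- `ρ⁻_{I,T}(z) = min {n ≥ 0 : T^{-n} z ∈ (u,v)}`. -/
def rhoMinusPt (T : Equiv.Perm ℝ) (u v z : ℝ) : ℕ :=
  sInf {n : ℕ | (T⁻¹ ^ n) z ∈ Set.Ioo u v}

/-- The set of neighbours `N_{I,T}(z)` of `z` with respect to `I = [u,v)` and `T`. -/
def neighbours (T : Equiv.Perm ℝ) (u v z : ℝ) : Set ℝ :=
  {w | ∃ k : ℤ, -(rhoMinusPt T u v z : ℤ) ≤ k ∧ k < (rhoPlusPt T u v z : ℤ) ∧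
    w = (T ^ k) z}

/-- The set of division points `Div(I,T)` of `I = [u,v)` with respect to `T`. -/
def divPoints (s : ℕ) (l : ℝ) (len : Fin s → ℝ) (T : Equiv.Perm ℝ)
    (u v : ℝ) : Set ℝ :=
  ⋃ i : Fin s, neighbours T u v (sepPt l len i)

/-- The semi-interval `[u,v) ⊆ [l,r)` is admissible for `T`. -/
def Admissible (s : ℕ) (l r : ℝ) (len : Fin s → ℝ) (T : Equiv.Perm ℝ)
    (u v : ℝ) : Prop :=
  l ≤ u ∧ u < v ∧ v ≤ r ∧
  u ∈ divPoints s l len T u v ∪ {r} ∧ v ∈ divPoints s l len T u v ∪ {r}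

/-- A bundled regular `s`-interval exchange transformation. -/
structure RIET (s : ℕ) where
  l : ℝ
  r : ℝ
  len : Fin s → ℝ
  perm : Equiv.Perm (Fin s)
  T : Equiv.Perm ℝ
  isIET : IsIET s l r len perm T
  isReg : IsRegularIET s l len T

/-- The right endpoint `max (γ_s, δ_{π(s)})` of `Z(T)`. -/
def zPoint {s : ℕ} (X : RIET s) : ℝ :=
  if h : 0 < s then
    max (sepPt X.l X.len ⟨s - 1, by omega⟩)
      (imgPt X.l X.len X.perm (X.perm.symm ⟨s - 1, by omega⟩))
  else X.r

/-- The left endpoint `min (γ_2, δ_{π(2)})` of `Y(T)`. -/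
def yPoint {s : ℕ} (X : RIET s) : ℝ :=
  if h : 1 < s then
    min (sepPt X.l X.len ⟨1, h⟩) (imgPt X.l X.len X.perm (X.perm.symm ⟨1, h⟩))
  else X.l

/-- `Y = ψ(X)`: one step of the right Rauzy induction. -/
def PsiStep {s : ℕ} (X Y : RIET s) : Prop :=
  Y.l = X.l ∧ Y.r = zPoint X ∧
  ∀ z ∈ Set.Ico X.l (zPoint X), Y.T z = inducedMap X.T (Set.Ico X.l (zPoint X)) z

/-- `Y = φ(X)`: one step of the left Rauzy induction. -/
def PhiStep {s : ℕ} (X Y : RIET s) : Prop :=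
  Y.l = yPoint X ∧ Y.r = X.r ∧
  ∀ z ∈ Set.Ico (yPoint X) X.r, Y.T z = inducedMap X.T (Set.Ico (yPoint X) X.r) z

/-- Equivalence of two `s`-interval exchange transformations: `(σ, mu)` is obtained
from `(π, lam)` by rescaling, possibly combined with the reversal `τ : i ↦ s - i + 1`. -/
def IETEquiv (s : ℕ) (π σ : Equiv.Perm (Fin s)) (lam mu : Fin s → ℝ) : Prop :=
  (∃ c : ℝ, 0 < c ∧ σ = π ∧ ∀ i, mu i = c * lam i) ∨
  (∃ c : ℝ, 0 < c ∧ (∀ i, σ i = (π i).rev) ∧ ∀ i, mu i = c * lam i.rev)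

/-- The subring `ℤ[√d]` of `ℝ`. -/
def Zsd (d : ℤ) : Set ℝ := {z | ∃ m n : ℤ, z = (m : ℝ) + (n : ℝ) * Real.sqrt d}

/-- `Ψ(z) = max (|m|,|n|)` for `z = m + n√d` (the representation being unique
when `d ≥ 2` is squarefree). -/
def PsiNum (d : ℤ) (z : ℝ) : ℕ :=
  sInf {k : ℕ | ∃ m n : ℤ, z = (m : ℝ) + (n : ℝ) * Real.sqrt d ∧
    k = max m.natAbs n.natAbs}

/-- `Ψ(S) = max {Ψ(z) : z ∈ ∂S}`. -/
def PsiSet (d : ℤ) (S : Set ℝ) : ℕ := sSup (PsiNum d '' frontier S)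

/-- The reduced complexity `Π(S) = |S| ⬝ Ψ(S)`. -/
def PiSet (d : ℤ) (S : Set ℝ) : ℝ := (volume S).toReal * PsiSet d S

/-- `S` belongs to the algebra `A([l,r))`: a nonempty finite union of semi-intervals
of `[l,r)` with endpoints in `ℤ[√d]`. -/
def MemA (d : ℤ) (l r : ℝ) (S : Set ℝ) : Prop :=
  S.Nonempty ∧ S ⊆ Set.Ico l r ∧
  ∃ (k : ℕ) (a b : Fin k → ℝ), (∀ j, a j ∈ Zsd d ∧ b j ∈ Zsd d ∧ a j < b j) ∧
    S = ⋃ j, Set.Ico (a j) (b j)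

/-- The interval exchange transformation with data `(l, r, len, π)` is defined over
`ℤ[√d]`: `l`, `r`, the separation points and the translation values lie in `ℤ[√d]`. -/
def DefinedOverZ (d : ℤ) (s : ℕ) (l r : ℝ) (len : Fin s → ℝ)
    (π : Equiv.Perm (Fin s)) : Prop :=
  l ∈ Zsd d ∧ r ∈ Zsd d ∧
  ∀ i, sepPt l len i ∈ Zsd d ∧ (imgPt l len π i - sepPt l len i) ∈ Zsd d

/-- Maximal positive return time `ρ⁺(S)`. -/
def rhoPlusSet (T : Equiv.Perm ℝ) (S : Set ℝ) : ℕ :=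
  sInf {n : ℕ | 1 ≤ n ∧ ⇑(T ^ n) '' S ⊆ ⋃ i ∈ Finset.range n, ⇑(T ^ i) '' S}

/-- Maximal negative return time `ρ⁻(S)`. -/
def rhoMinusSet (T : Equiv.Perm ℝ) (S : Set ℝ) : ℕ :=
  sInf {m : ℕ | 1 ≤ m ∧ ⇑(T ^ m) '' S ⊆ ⋃ i ∈ Finset.range m, ⇑(T⁻¹ ^ i) '' S}

/-- Minimal positive return time `σ⁺(S)`. -/
def sigmaPlusSet (T : Equiv.Perm ℝ) (S : Set ℝ) : ℕ :=
  sInf {n : ℕ | 1 ≤ n ∧ (⇑(T ^ n) '' S ∩ S).Nonempty}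

/-- Minimal negative return time `σ⁻(S)`. -/
def sigmaMinusSet (T : Equiv.Perm ℝ) (S : Set ℝ) : ℕ :=
  sInf {m : ℕ | 1 ≤ m ∧ (⇑(T⁻¹ ^ m) '' S ∩ S).Nonempty}

/-- `D_{m,n}(T) = ⋃_{i=-m+1}^{n} T^i (Sep(T))`. -/
def Dmn (s : ℕ) (l : ℝ) (len : Fin s → ℝ) (T : Equiv.Perm ℝ) (m n : ℕ) : Set ℝ :=
  {w | ∃ (i : Fin s) (k : ℤ), -(m : ℤ) + 1 ≤ k ∧ k ≤ (n : ℤ) ∧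
    w = (T ^ k) (sepPt l len i)}

/-- `[u,v)` belongs to `U(T) = ⋃_{m,n ≥ 1} U_{m,n}(T)`: it is one of the
semi-intervals into which `D_{m,n}(T)` partitions `[l,r)`. -/
def MemU (s : ℕ) (l r : ℝ) (len : Fin s → ℝ) (T : Equiv.Perm ℝ) (u v : ℝ) : Prop :=
  ∃ m n : ℕ, 1 ≤ m ∧ 1 ≤ n ∧ u ∈ Dmn s l len T m n ∧
    (v ∈ Dmn s l len T m n ∨ v = r) ∧ ∀ w ∈ Dmn s l len T m n, w ∉ Set.Ioo u v

/-- `T` maps `[l,r)` to itself and is a translation between consecutive points of the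
finite set `S ∋ l`. -/
structure IsPiecewiseTranslation (T : Equiv.Perm ℝ) (l r : ℝ) (S : Set ℝ) : Prop where
  finite : S.Finite
  left_mem : l ∈ S
  mapsTo : ∀ x ∈ Ico l r, T x ∈ Ico l r
  translate : ∀ a ∈ Ico l r, ∀ x ∈ Ico l r, a ≤ x → (∀ s ∈ S, s ∉ Ioc a x) →
    T x = T a + (x - a)

theorem perm_pow_succ_apply (T : Equiv.Perm ℝ) (n : ℕ) (x : ℝ) :
    (T ^ (n + 1)) x = T ((T ^ n) x) := by
  rw [pow_succ', Equiv.Perm.mul_apply]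

theorem perm_pow_add_apply (T : Equiv.Perm ℝ) (m n : ℕ) (x : ℝ) :
    (T ^ (m + n)) x = (T ^ m) ((T ^ n) x) := by
  rw [pow_add, Equiv.Perm.mul_apply]

theorem Set.Finite.exists_pos_le_abs_sub {P : Set ℝ} (hP : P.Finite) (y : ℝ) :
    ∃ t > 0, ∀ p ∈ P, p ≠ y → t ≤ |p - y| := by
  have hc : IsClosed (P \ {y}) := (hP.subset sdiff_subset).isClosed
  have hy : (P \ {y})ᶜ ∈ nhds y := hc.isOpen_compl.mem_nhds (by simp)
  obtain ⟨t, ht, hb⟩ := Metric.mem_nhds_iff.1 hy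
  refine ⟨t, ht, fun p hp hne => ?_⟩
  by_contra! hlt
  exact hb (show p ∈ Metric.ball y t by rwa [Metric.mem_ball, Real.dist_eq]) ⟨hp, hne⟩

/-- An infinite sequence in a bounded interval has two terms at distance less than `t`. -/
theorem exists_lt_abs_sub_lt {l r t : ℝ} (ht : 0 < t) (f : ℕ → ℝ)
    (hf : ∀ n, f n ∈ Ico l r) : ∃ m n, m < n ∧ |f m - f n| < t := by
  have hmem : ∀ n, ⌊f n / t⌋ ∈ Icc ⌊l / t⌋ ⌊r / t⌋ := fun n =>
    ⟨Int.floor_le_floor (div_le_div_of_nonneg_right (hf n).1 ht.le),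
      Int.floor_le_floor (div_le_div_of_nonneg_right (hf n).2.le ht.le)⟩
  obtain ⟨m, n, hmn, h⟩ :=
    (finite_Icc ⌊l / t⌋ ⌊r / t⌋).exists_lt_map_eq_of_forall_mem hmem
  refine ⟨m, n, hmn, ?_⟩
  have h1 := Int.abs_sub_lt_one_of_floor_eq_floor h
  rwa [← sub_div, abs_div, abs_of_pos ht, div_lt_one ht] at h1

namespace IsPiecewiseTranslation

variable {T : Equiv.Perm ℝ} {l r : ℝ} {S : Set ℝ}

theorem pow_mem (hT : IsPiecewiseTranslation T l r S) {x : ℝ} (hx : x ∈ Ico l r) (n : ℕ) :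
    (T ^ n) x ∈ Ico l r := by
  induction n with
  | zero => simpa using hx
  | succ n ih => rw [perm_pow_succ_apply]; exact hT.mapsTo _ ih

/-- A periodic point forces a periodic singularity. -/
theorem exists_periodic_mem (hT : IsPiecewiseTranslation T l r S) {x : ℝ}
    (hx : x ∈ Ico l r) {n : ℕ} (hn : 0 < n) (hper : (T ^ n) x = x) :
    ∃ s ∈ S, (T ^ n) s = s := by
  have hfloor : ∀ y ∈ Ico l r, ∃ s ∈ S, s ≤ y ∧ l ≤ s ∧ ∀ s' ∈ S, s' ∉ Ioc s y := by
    intro y hy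
    obtain ⟨s, hs, hmax⟩ := exists_max_image (S ∩ Iic y) id
      (hT.finite.subset inter_subset_left) ⟨l, hT.left_mem, hy.1⟩
    exact ⟨s, hs.1, hs.2, hmax l ⟨hT.left_mem, hy.1⟩,
      fun s' hs' h => absurd (hmax s' ⟨hs', h.2⟩) (not_le.2 h.1)⟩
  choose! σ hσS hσle hσl hσ using hfloor
  have hxk := fun k => hT.pow_mem hx k
  obtain ⟨k₀, hk₀, hmin⟩ := (Finset.range n).exists_min_image
    (fun k => (T ^ k) x - σ ((T ^ k) x)) ⟨0, by simpa using hn⟩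
  set d := (T ^ k₀) x - σ ((T ^ k₀) x) with hd
  have hd0 : 0 ≤ d := sub_nonneg.2 (hσle _ (hxk k₀))
  have key : ∀ k ≤ n, (T ^ k) (x - d) = (T ^ k) x - d := by
    intro k
    induction k with
    | zero => simp
    | succ k ih =>
      intro hk
      have h1 := hmin k (by simpa using hk)
      have h2 := hσl _ (hxk k)
      have h3 := hxk k
      have h4 := hT.translate ((T ^ k) x - d) ⟨by linarith, by linarith [h3.2]⟩ _ h3
        (by linarith) (fun s hs h => hσ _ h3 s hs ⟨by linarith [h.1], h.2⟩)
      rw [perm_pow_succ_apply, perm_pow_succ_apply, ih (by omega), h4]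
      ring
  have hs : (T ^ k₀) (x - d) = σ ((T ^ k₀) x) := by
    rw [key k₀ (by simp at hk₀; omega), hd]; ring
  refine ⟨σ ((T ^ k₀) x), hσS _ (hxk k₀), ?_⟩
  rw [← hs, ← perm_pow_add_apply, add_comm, perm_pow_add_apply, key n le_rfl, hper]

/-- Every iterate is a translation on a right neighbourhood of each point. -/
theorem exists_right_translate (hT : IsPiecewiseTranslation T l r S) {x : ℝ}
    (hx : x ∈ Ico l r) (n : ℕ) :
    ∃ ε > 0, x + ε ≤ r ∧ ∀ d, 0 ≤ d → d < ε → (T ^ n) (x + d) = (T ^ n) x + d := by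
  induction n with
  | zero => exact ⟨r - x, by linarith [hx.2], by linarith, by simp⟩
  | succ n ih =>
    obtain ⟨ε, hε, hεr, h⟩ := ih
    obtain ⟨t, ht, hS⟩ := hT.finite.exists_pos_le_abs_sub ((T ^ n) x)
    refine ⟨min ε t, lt_min hε ht, by linarith [min_le_left ε t], fun d hd0 hd => ?_⟩
    have hdε := lt_of_lt_of_le hd (min_le_left ε t)
    have hdt := lt_of_lt_of_le hd (min_le_right ε t)
    have hm : (T ^ n) (x + d) ∈ Ico l r :=
      hT.pow_mem ⟨by linarith [hx.1], by linarith⟩ n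
    rw [perm_pow_succ_apply, perm_pow_succ_apply]
    rw [h d hd0 hdε] at hm ⊢
    rw [hT.translate _ (hT.pow_mem hx n) _ hm (by linarith), add_sub_cancel_left]
    intro s hs hsm
    have h1 := hS s hs hsm.1.ne'
    rw [abs_of_pos (by linarith [hsm.1])] at h1
    linarith [hsm.2]

/-- Every point of a subinterval `[u,v)` returns to it. -/
theorem exists_return (hT : IsPiecewiseTranslation T l r S) {u v y : ℝ}
    (hlu : l ≤ u) (hvr : v ≤ r) (hy : y ∈ Ico u v) :
    ∃ n : ℕ, 0 < n ∧ (T ^ n) y ∈ Ico u v := by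
  by_contra! hno
  set Q := insert (T⁻¹ u) S
  have hQfin : Q.Finite := hT.finite.insert _
  set P := ⋃ q ∈ Q, {p | p ∈ Ico u v ∧ ∃ k : ℕ, (T ^ k) p = q ∧
    ∀ m, 1 ≤ m → m ≤ k → (T ^ m) p ∉ Ico u v}
  have hPfin : P.Finite := by
    refine hQfin.biUnion fun q _ => Set.Subsingleton.finite ?_
    have hlt : ∀ (p p' : ℝ) (k k' : ℕ), (T ^ k) p = (T ^ k') p' → k ≤ k' →
        p = (T ^ (k' - k)) p' := by
      intro p p' k k' h hk
      obtain ⟨j, rfl⟩ := Nat.exists_eq_add_of_le hk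
      rw [perm_pow_add_apply] at h
      simpa using (T ^ k).injective h
    have hle : ∀ (p p' : ℝ) (k k' : ℕ), p ∈ Ico u v → (T ^ k) p = (T ^ k') p' → k ≤ k' →
        (∀ m, 1 ≤ m → m ≤ k' → (T ^ m) p' ∉ Ico u v) → p = p' := by
      intro p p' k k' hp h hk hav
      have h1 := hlt p p' k k' h hk
      rcases hk.eq_or_lt with rfl | hk
      · simpa using h1
      · exact absurd (h1 ▸ hp) (hav _ (by omega) (by omega))
    rintro p ⟨hp, k, hk, hav⟩ p' ⟨hp', k', hk', hav'⟩
    rcases le_total k k' with hkk | hkk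
    · exact hle p p' k k' hp (hk.trans hk'.symm) hkk hav'
    · exact (hle p' p k' k hp' (hk'.trans hk.symm) hkk hav).symm
  obtain ⟨t₀, ht₀, hPt⟩ := hPfin.exists_pos_le_abs_sub y
  set t := min t₀ (v - y)
  have ht : 0 < t := lt_min ht₀ (by linarith [hy.2])
  have htv : t ≤ v - y := min_le_right _ _
  have hPt' : ∀ d, 0 < d → d < t → y + d ∉ P := by
    intro d hd0 hd hp
    have h1 := hPt _ hp (by linarith)
    rw [add_sub_cancel_left, abs_of_pos hd0] at h1
    linarith [min_le_left t₀ (v - y)]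
  have hK : ∀ d, 0 ≤ d → d < t → y + d ∈ Ico u v := fun d hd0 hd =>
    ⟨by linarith [hy.1], by linarith⟩
  have hKr : ∀ d, 0 ≤ d → d < t → y + d ∈ Ico l r := fun d hd0 hd =>
    ⟨by linarith [hy.1], by linarith⟩
  have hyr : y ∈ Ico l r := ⟨by linarith [hy.1], by linarith [hy.2]⟩
  have key : ∀ n : ℕ, ∀ d, 0 ≤ d → d < t →
      (T ^ n) (y + d) = (T ^ n) y + d ∧ (1 ≤ n → (T ^ n) (y + d) ∉ Ico u v) := by
    intro n
    induction n using Nat.strong_induction_on with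
    | _ n ih =>
      rcases n with _ | n
      · simp
      have hnotQ : ∀ d, 0 < d → d < t → (T ^ n) (y + d) ∉ Q := by
        intro d hd0 hd hq
        refine hPt' d hd0 hd (mem_iUnion₂.2 ⟨_, hq, hK d hd0.le hd, n, rfl, ?_⟩)
        intro m hm hmn
        exact (ih m (by omega) d hd0.le hd).2 hm
      have htr : ∀ d, 0 ≤ d → d < t → (T ^ (n + 1)) (y + d) = (T ^ (n + 1)) y + d := by
        intro d hd0 hd
        have hm := hT.pow_mem (hKr d hd0 hd) n
        rw [perm_pow_succ_apply, perm_pow_succ_apply]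
        rw [(ih n (by omega) d hd0 hd).1] at hm ⊢
        rw [hT.translate _ (hT.pow_mem hyr n) _ hm (by linarith), add_sub_cancel_left]
        intro s hs hsm
        refine hnotQ (s - (T ^ n) y) (by linarith [hsm.1]) (by linarith [hsm.2]) ?_
        rw [(ih n (by omega) _ (by linarith [hsm.1]) (by linarith [hsm.2])).1]
        exact mem_insert_of_mem _ (by simpa using hs)
      intro d hd0 hd
      refine ⟨htr d hd0 hd, fun _ hin => ?_⟩
      have hlow : (T ^ (n + 1)) y < u := by
        by_contra! hge
        refine hno (n + 1) (by omega) ⟨hge, ?_⟩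
        have := hin.2
        rw [htr d hd0 hd] at this
        linarith
      have hup : u ≤ (T ^ (n + 1)) y + d := htr d hd0 hd ▸ hin.1
      refine hnotQ (u - (T ^ (n + 1)) y) (by linarith) (by linarith) (mem_insert_iff.2 (Or.inl ?_))
      rw [Equiv.Perm.eq_inv_iff_eq, ← perm_pow_succ_apply, htr _ (by linarith) (by linarith)]
      ring
  obtain ⟨k, m, hkm, hlt⟩ := exists_lt_abs_sub_lt ht _ (hT.pow_mem hyr)
  obtain ⟨j, rfl⟩ := Nat.exists_eq_add_of_lt hkm
  rw [add_assoc] at hlt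
  have hj : ∀ d, 0 ≤ d → d < t → (T ^ (j + 1)) (y + d) ∉ Ico u v := fun d hd0 hd =>
    (key _ d hd0 hd).2 (by omega)
  rcases le_total ((T ^ k) y) ((T ^ (k + (j + 1))) y) with hle | hle
  · rw [abs_sub_comm, abs_of_nonneg (by linarith)] at hlt
    set d := (T ^ (k + (j + 1))) y - (T ^ k) y with hd
    have h1 := (key k d (by linarith) hlt).1
    have h2 : (T ^ k) (y + d) = (T ^ k) ((T ^ (j + 1)) y) := by
      rw [h1, ← perm_pow_add_apply, hd]; ring
    have h3 := (T ^ k).injective h2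
    exact hno (j + 1) (by omega) (h3 ▸ hK d (by linarith) hlt)
  · rw [abs_of_nonneg (by linarith)] at hlt
    set d := (T ^ k) y - (T ^ (k + (j + 1))) y with hd
    have h1 := (key (k + (j + 1)) d (by linarith) hlt).1
    have h2 : (T ^ k) ((T ^ (j + 1)) (y + d)) = (T ^ k) y := by
      rw [← perm_pow_add_apply, h1, hd]; ring
    refine hj d (by linarith) hlt ?_
    rw [(T ^ k).injective h2]
    exact hy

/-- The right endpoint of a gap of an invariant set reaches a singularity. -/
theorem exists_pow_mem_of_gap (hT : IsPiecewiseTranslation T l r S)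
    (hper : ∀ x ∈ Ico l r, ∀ n : ℕ, 0 < n → (T ^ n) x ≠ x) {V : Set ℝ}
    (hV : ∀ x ∈ Ico l r, T x ∈ V ↔ x ∈ V) {b c : ℝ} (hb : b ∈ Ico l r) (hbV : b ∈ V)
    (hlc : l ≤ c) (hcb : c < b) (hgap : ∀ w ∈ Ioo c b, w ∉ V) :
    ∃ n : ℕ, (T ^ n) b ∈ S := by
  by_contra! hS
  have hbr := fun n => hT.pow_mem hb n
  have hbnV : ∀ n, (T ^ n) b ∈ V := by
    intro n
    induction n with
    | zero => simpa using hbV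
    | succ n ih => rw [perm_pow_succ_apply, hV _ (hbr n)]; exact ih
  have hne : ∀ m n, m < n → (T ^ m) b ≠ (T ^ n) b := by
    intro m n hmn h
    obtain ⟨j, rfl⟩ := Nat.exists_eq_add_of_lt hmn
    rw [add_assoc, perm_pow_add_apply] at h
    exact hper b hb (j + 1) (by omega) ((T ^ m).injective h).symm
  let G : ℕ → ℝ → Prop := fun n t => 0 < t ∧ l ≤ (T ^ n) b - t ∧
    ∀ w, (T ^ n) b - t < w → w < (T ^ n) b → w ∉ V
  have step : ∀ n t, G n t → (∀ s ∈ S, s ∉ Ioc ((T ^ n) b - t) ((T ^ n) b)) →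
      G (n + 1) t := by
    rintro n t ⟨ht, hl, hw⟩ hs
    have htr : ∀ d, 0 ≤ d → d ≤ t → T ((T ^ n) b - d) = (T ^ (n + 1)) b - d := by
      intro d hd0 hd
      have := hT.translate ((T ^ n) b - d) ⟨by linarith, by linarith [(hbr n).2]⟩ _ (hbr n)
        (by linarith) (fun s hsS h => hs s hsS ⟨by linarith [h.1], h.2⟩)
      rw [perm_pow_succ_apply, this]; ring
    refine ⟨ht, ?_, fun w hw1 hw2 hwV => ?_⟩
    · rw [← htr t ht.le le_rfl]
      exact (hT.mapsTo _ ⟨hl, by linarith [(hbr n).2]⟩).1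
    · have h1 := htr ((T ^ (n + 1)) b - w) (by linarith) (by linarith)
      rw [sub_sub_cancel] at h1
      rw [← h1, hV _ ⟨by linarith, by linarith [(hbr n).2]⟩] at hwV
      exact hw _ (by linarith) (by linarith) hwV
  have hex : ∀ n, ∃ t, G n t := by
    intro n
    induction n with
    | zero => exact ⟨b - c, by linarith, by simpa using hlc, fun w h1 h2 =>
        hgap w ⟨by simpa using h1, by simpa using h2⟩⟩
    | succ n ih =>
      obtain ⟨t, ht, hl, hw⟩ := ih
      obtain ⟨ε, hε, hSε⟩ := hT.finite.exists_pos_le_abs_sub ((T ^ n) b)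
      have h1 := min_le_left t ε
      have h2 := min_le_right t ε
      refine ⟨min t ε, step n _ ⟨lt_min ht hε, by linarith, fun w hw1 hw2 =>
        hw w (by linarith) hw2⟩ fun s hs hsm => ?_⟩
      have hsn : s ≠ (T ^ n) b := fun h => hS n (h ▸ hs)
      have h3 := hSε s hs hsn
      rw [abs_of_nonpos (by linarith [hsm.2])] at h3
      linarith [hsm.1]
  have hev : ∀ s ∈ S, ∀ᶠ n in Filter.atTop, ∀ t, G n t → s ∉ Ioc ((T ^ n) b - t) ((T ^ n) b) := by
    intro s hs
    by_cases h : ∃ n t, G n t ∧ s ∈ Ioc ((T ^ n) b - t) ((T ^ n) b)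
    · obtain ⟨n, t, hG, hsn⟩ := h
      filter_upwards [Filter.eventually_gt_atTop n] with m hm t' hG' hsm
      have hsn' := lt_of_le_of_ne hsn.2 (fun h => hS n (h ▸ hs))
      have hsm' := lt_of_le_of_ne hsm.2 (fun h => hS m (h ▸ hs))
      rcases lt_or_gt_of_ne (hne n m hm) with hlt | hlt
      · exact hG'.2.2 _ (by linarith [hsm.1]) hlt (hbnV n)
      · exact hG.2.2 _ (by linarith [hsn.1]) hlt (hbnV m)
    · push Not at h
      exact Filter.Eventually.of_forall h
  obtain ⟨N, hN⟩ := Filter.eventually_atTop.1 ((Filter.eventually_all_finite hT.finite).2 hev)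
  obtain ⟨t, ht⟩ := hex N
  have hall : ∀ n, G (N + n) t := by
    intro n
    induction n with
    | zero => simpa using ht
    | succ n ih => exact step _ _ ih fun s hs => hN _ (Nat.le_add_right N n) s hs t ih
  obtain ⟨m, n, hmn, hlt⟩ := exists_lt_abs_sub_lt ht.1 (fun n => (T ^ (N + n)) b)
    (fun n => hbr _)
  rw [abs_lt] at hlt
  rcases lt_or_gt_of_ne (hne (N + m) (N + n) (by omega)) with h | h
  · exact (hall n).2.2 _ (by linarith [hlt.1]) h (hbnV _)
  · exact (hall m).2.2 _ (by linarith [hlt.2]) h (hbnV _)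

/-- If no singularity of `T⁻¹` is connected to a singularity of `T`, an invariant set has
no gap ending at one of its points. -/
theorem false_of_gap {S' : Set ℝ} (hT : IsPiecewiseTranslation T l r S)
    (hT' : IsPiecewiseTranslation T⁻¹ l r S')
    (hper : ∀ x ∈ Ico l r, ∀ n : ℕ, 0 < n → (T ^ n) x ≠ x)
    (hconn : ∀ b ∈ Ioo l r, ∀ m n : ℕ, (T ^ n) b ∈ S → (T⁻¹ ^ m) b ∉ S')
    {V : Set ℝ} (hV : ∀ x ∈ Ico l r, T x ∈ V ↔ x ∈ V) {b c : ℝ} (hlc : l ≤ c) (hcb : c < b)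
    (hbr : b < r) (hbV : b ∈ V) (hgap : ∀ w ∈ Ioo c b, w ∉ V) : False := by
  have hb : b ∈ Ico l r := ⟨by linarith, hbr⟩
  obtain ⟨n, hn⟩ := hT.exists_pow_mem_of_gap hper hV hb hbV hlc hcb hgap
  have hper' : ∀ x ∈ Ico l r, ∀ n : ℕ, 0 < n → (T⁻¹ ^ n) x ≠ x := by
    intro x hx n hn h
    rw [inv_pow, Equiv.Perm.inv_eq_iff_eq] at h
    exact hper x hx n hn h.symm
  have hV' : ∀ x ∈ Ico l r, T⁻¹ x ∈ V ↔ x ∈ V := by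
    intro x hx
    rw [← hV _ (hT'.mapsTo x hx), ← Equiv.Perm.mul_apply, mul_inv_cancel,
      Equiv.Perm.one_apply]
  obtain ⟨m, hm⟩ := hT'.exists_pow_mem_of_gap hper' hV' hb hbV hlc hcb hgap
  exact hconn b ⟨by linarith, hbr⟩ m n hn hm

/-- If no singularity of `T⁻¹` is connected to a singularity of `T`, every forward orbit
visits every open subinterval. -/
theorem exists_pow_mem_Ioo {S' : Set ℝ} (hT : IsPiecewiseTranslation T l r S)
    (hT' : IsPiecewiseTranslation T⁻¹ l r S')
    (hper : ∀ x ∈ Ico l r, ∀ n : ℕ, 0 < n → (T ^ n) x ≠ x)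
    (hconn : ∀ b ∈ Ioo l r, ∀ m n : ℕ, (T ^ n) b ∈ S → (T⁻¹ ^ m) b ∉ S')
    {u v x : ℝ} (hlu : l ≤ u) (huv : u < v) (hvr : v ≤ r) (hx : x ∈ Ico l r) :
    ∃ n : ℕ, 0 < n ∧ (T ^ n) x ∈ Ioo u v := by
  obtain ⟨u', huu', hu'v⟩ := exists_between huv
  have hret : ∀ y ∈ Ico u' v, ∃ n : ℕ, 0 < n ∧ (T ^ n) y ∈ Ico u' v := fun y hy =>
    hT.exists_return (by linarith) hvr hy
  set U : Set ℝ := {y | ∃ n : ℕ, (T ^ n) y ∈ Ico u' v}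
  have hUT : ∀ y, T y ∈ U ↔ y ∈ U := by
    intro y
    constructor
    · rintro ⟨n, hn⟩
      exact ⟨n + 1, by rwa [perm_pow_add_apply, pow_one]⟩
    · rintro ⟨n, hn⟩
      obtain ⟨n, hn0, hn⟩ : ∃ n : ℕ, 0 < n ∧ (T ^ n) y ∈ Ico u' v := by
        rcases Nat.eq_zero_or_pos n with rfl | h
        · exact hret y (by simpa using hn)
        · exact ⟨n, h, hn⟩
      obtain ⟨k, rfl⟩ := Nat.exists_eq_succ_of_ne_zero hn0.ne'
      exact ⟨k, by rwa [Nat.succ_eq_add_one, perm_pow_add_apply, pow_one] at hn⟩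
  have hUright : ∀ y ∈ Ico l r, y ∈ U → ∃ ε > 0, ∀ d, 0 ≤ d → d < ε → y + d ∈ U := by
    rintro y hy ⟨n, hn⟩
    obtain ⟨ε, hε, -, h⟩ := hT.exists_right_translate hy n
    have h1 := min_le_left ε (v - (T ^ n) y)
    have h2 := min_le_right ε (v - (T ^ n) y)
    refine ⟨min ε (v - (T ^ n) y), lt_min hε (by linarith [hn.2]), fun d hd0 hd => ⟨n, ?_⟩⟩
    rw [h d hd0 (by linarith)]
    exact ⟨by linarith [hn.1], by linarith⟩
  have hIU : ∀ y ∈ Ico u' v, y ∈ U := fun y hy => ⟨0, by simpa using hy⟩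
  suffices hall : ∀ y ∈ Ico l r, y ∈ U by
    obtain ⟨n, hn⟩ := hall (T x) (hT.mapsTo x hx)
    refine ⟨n + 1, by omega, ?_⟩
    rw [perm_pow_add_apply, pow_one]
    exact ⟨by linarith [hn.1], hn.2⟩
  set F : Set ℝ := Ico l r \ U with hF
  have hFT : ∀ y ∈ Ico l r, T y ∈ F ↔ y ∈ F := fun y hy => by
    simp [hF, hUT, hT.mapsTo y hy, -mem_Ico, hy]
  have hUr : ∀ y ∈ Ico l r, y ∈ U → ∀ w ∈ F, w < y := by
    intro y hy hyU w hwF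
    by_contra! hle
    set A := F ∩ Ici y
    have hAne : A.Nonempty := ⟨w, hwF, hle⟩
    have hAbdd : BddBelow A := ⟨y, fun a ha => ha.2⟩
    set b := sInf A
    have hyb : y ≤ b := le_csInf hAne fun a ha => ha.2
    have hbr : b < r := (csInf_le hAbdd ⟨hwF, hle⟩).trans_lt hwF.1.2
    have hgap : ∀ z ∈ Ioo y b, z ∉ F := fun z hz hzF =>
      absurd (csInf_le hAbdd ⟨hzF, hz.1.le⟩) (not_le.2 hz.2)
    have hbF : b ∈ F := by
      refine ⟨⟨hy.1.trans hyb, hbr⟩, fun hbU => ?_⟩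
      obtain ⟨ε, hε, h⟩ := hUright b ⟨hy.1.trans hyb, hbr⟩ hbU
      obtain ⟨a, ha, hab⟩ := exists_lt_of_csInf_lt hAne (show sInf A < b + ε by linarith)
      have hba := csInf_le hAbdd ha
      have := h (a - b) (by linarith) (by linarith)
      rw [add_sub_cancel] at this
      exact ha.1.2 this
    have hyb' : y < b := lt_of_le_of_ne hyb fun h => hbF.2 (h ▸ hyU)
    exact false_of_gap hT hT' hper hconn hFT hy.1 hyb' hbr hbF hgap
  by_contra! hne
  obtain ⟨y₀, hy₀, hy₀U⟩ := hne
  have hFne : F.Nonempty := ⟨y₀, hy₀, hy₀U⟩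
  have hu'r : u' ∈ Ico l r := ⟨by linarith, by linarith⟩
  have hFu : ∀ w ∈ F, w < u' := hUr u' hu'r (hIU u' ⟨le_rfl, hu'v⟩)
  have hFbdd : BddAbove F := ⟨u', fun w hw => (hFu w hw).le⟩
  set c := sSup F
  have hlc : l ≤ c := hy₀.1.trans (le_csSup hFbdd ⟨hy₀, hy₀U⟩)
  have hcr : c < r := (csSup_le hFne fun w hw => (hFu w hw).le).trans_lt hu'r.2
  have hgtU : ∀ w, c < w → w < r → w ∈ U := by
    intro w hcw hwr
    by_contra hwU
    exact absurd (le_csSup hFbdd ⟨⟨by linarith, hwr⟩, hwU⟩) (not_le.2 hcw)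
  have hltU : ∀ w, l ≤ w → w < c → w ∉ U := by
    intro w hlw hwc hwU
    obtain ⟨a, ha, hwa⟩ := exists_lt_of_lt_csSup hFne hwc
    exact absurd (hUr w ⟨hlw, by linarith⟩ hwU a ha) (not_lt.2 hwa.le)
  by_cases hcU : c ∈ U
  · have hyc : y₀ < c := lt_of_le_of_ne (le_csSup hFbdd ⟨hy₀, hy₀U⟩) fun h => hy₀U (h ▸ hcU)
    exact false_of_gap hT hT' hper hconn (fun y _ => hUT y) hy₀.1 hyc hcr hcU
      fun w hw => hltU w (hy₀.1.trans hw.1.le) hw.2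
  · have hcF : c ∈ F := ⟨⟨hlc, hcr⟩, hcU⟩
    have hTcF : T c ∈ F := (hFT c hcF.1).2 hcF
    refine hper c hcF.1 1 one_pos ?_
    rw [pow_one]
    by_contra hTc
    have hlt : T c < c := lt_of_le_of_ne (le_csSup hFbdd hTcF) hTc
    obtain ⟨ε, hε, hεr, h⟩ := hT.exists_right_translate hcF.1 1
    obtain ⟨d, hd0, hd⟩ := exists_between (lt_min hε (sub_pos.2 hlt))
    have hd1 := hd.trans_le (min_le_left _ _)
    have hd2 := hd.trans_le (min_le_right _ _)
    have h1 := h d hd0.le hd1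
    rw [pow_one] at h1
    refine hltU (T c + d) (by linarith [hTcF.1.1]) (by linarith) ?_
    rw [← h1, hUT]
    exact hgtU _ (by linarith) (by linarith)

end IsPiecewiseTranslation

section IntervalPartition

variable {s : ℕ} {l r : ℝ} {len : Fin s → ℝ}

theorem imgPt_eq_sepPt (l : ℝ) (len : Fin s → ℝ) (π : Equiv.Perm (Fin s)) (i : Fin s) :
    imgPt l len π i = sepPt l (fun k => len (π.symm k)) (π i) := by
  unfold imgPt sepPt
  congr 1
  refine Finset.sum_bij (fun j _ => π j) (by simp) (by simp) ?_ (by simp)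
  intro k hk
  exact ⟨π.symm k, by simpa using hk, by simp⟩

theorem sepPt_zero (l : ℝ) (len : Fin s → ℝ) (h : 0 < s) : sepPt l len ⟨0, h⟩ = l := by
  have : Finset.univ.filter (fun j : Fin s => j < ⟨0, h⟩) = ∅ := by
    ext j; simp [Fin.lt_def]
  simp [sepPt, this]

theorem sepPt_succ (l : ℝ) (len : Fin s → ℝ) (i : Fin s) (h : (i : ℕ) + 1 < s) :
    sepPt l len ⟨i + 1, h⟩ = sepPt l len i + len i := by
  have : Finset.univ.filter (fun j : Fin s => j < ⟨i + 1, h⟩) =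
      insert i (Finset.univ.filter (fun j => j < i)) := by
    ext j
    simp only [Finset.mem_insert, Finset.mem_filter, Finset.mem_univ, true_and, Fin.lt_def,
      Fin.ext_iff]
    omega
  rw [sepPt, sepPt, this, Finset.sum_insert (by simp)]
  ring

theorem sepPt_add_len_last (hsum : ∑ i, len i = r - l) (i : Fin s) (h : (i : ℕ) + 1 = s) :
    sepPt l len i + len i = r := by
  have : (Finset.univ : Finset (Fin s)) = insert i (Finset.univ.filter (fun j => j < i)) := by
    ext j
    simp only [Finset.mem_insert, Finset.mem_filter, Finset.mem_univ, true_and, true_iff,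
      Fin.lt_def, Fin.ext_iff]
    have := j.2
    omega
  rw [this, Finset.sum_insert (by simp)] at hsum
  rw [sepPt]
  linarith

theorem sepPt_add_len_eq (hsum : ∑ i, len i = r - l) (i : Fin s) :
    sepPt l len i + len i = r ∨ ∃ k, sepPt l len k = sepPt l len i + len i := by
  rcases (Nat.succ_le_of_lt i.2).eq_or_lt with h | h
  · exact Or.inl (sepPt_add_len_last hsum i h)
  · exact Or.inr ⟨_, sepPt_succ l len i h⟩

theorem le_sepPt (hpos : ∀ i, 0 < len i) (i : Fin s) : l ≤ sepPt l len i :=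
  le_add_of_nonneg_right (Finset.sum_nonneg fun j _ => (hpos j).le)

theorem sepPt_add_len_le (hpos : ∀ i, 0 < len i) (hsum : ∑ i, len i = r - l) (i : Fin s) :
    sepPt l len i + len i ≤ r := by
  have h : ∑ j ∈ insert i (Finset.univ.filter (fun j => j < i)), len j ≤ ∑ j, len j :=
    Finset.sum_le_sum_of_subset_of_nonneg (Finset.subset_univ _) fun j _ _ => (hpos j).le
  rw [Finset.sum_insert (by simp)] at h
  rw [sepPt]
  linarith

theorem exists_mem_Ico_sepPt (hs : 0 < s) (hpos : ∀ i, 0 < len i)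
    (hsum : ∑ i, len i = r - l) {z : ℝ} (hz : z ∈ Ico l r) :
    ∃ i, z ∈ Ico (sepPt l len i) (sepPt l len i + len i) := by
  obtain ⟨i, hi, hmax⟩ := exists_max_image {i | sepPt l len i ≤ z} (sepPt l len)
    (toFinite _) ⟨⟨0, hs⟩, by rw [mem_ofPred_eq, sepPt_zero]; exact hz.1⟩
  refine ⟨i, hi, lt_of_not_ge fun hge => ?_⟩
  rcases sepPt_add_len_eq hsum i with h | ⟨k, hk⟩
  · linarith [hz.2]
  · linarith [hmax k (show _ ≤ z by linarith), hpos i]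

/-- A map of `[l,r)` that translates each semi-interval of a partition is a piecewise
translation. -/
theorem isPiecewiseTranslation_of_translate {T : Equiv.Perm ℝ} (hs : 0 < s)
    (hpos : ∀ i, 0 < len i) (hsum : ∑ i, len i = r - l)
    (hmaps : ∀ x ∈ Ico l r, T x ∈ Ico l r) (α : Fin s → ℝ)
    (hα : ∀ i, ∀ z ∈ Ico (sepPt l len i) (sepPt l len i + len i), T z = z + α i) :
    IsPiecewiseTranslation T l r (range (sepPt l len)) where
  finite := finite_range _
  left_mem := ⟨⟨0, hs⟩, sepPt_zero l len hs⟩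
  mapsTo := hmaps
  translate a ha x hx hax hS := by
    obtain ⟨i, hi⟩ := exists_mem_Ico_sepPt hs hpos hsum ha
    have hxi : x < sepPt l len i + len i := by
      by_contra! hge
      rcases sepPt_add_len_eq hsum i with h | ⟨k, hk⟩
      · linarith [hx.2]
      · exact hS _ ⟨k, rfl⟩ ⟨by linarith [hi.2], by linarith⟩
    rw [hα i a hi, hα i x ⟨hi.1.trans hax, hxi⟩]
    ring

end IntervalPartition

theorem orbitZ_finite_of_periodic {T : Equiv.Perm ℝ} {x : ℝ} {n : ℕ} (hn : 0 < n)
    (h : (T ^ n) x = x) : (orbitZ T x).Finite := by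
  refine ((finite_Ico (0 : ℤ) n).image fun k => (T ^ k) x).subset ?_
  rintro w ⟨m, rfl⟩
  have hn' : (n : ℤ) ≠ 0 := by omega
  refine ⟨m % n, ⟨Int.emod_nonneg _ hn', Int.emod_lt_of_pos _ (by omega)⟩, ?_⟩
  have h1 : (T ^ ((n : ℤ) * (m / n))) x = x := by
    rw [zpow_mul]
    exact Equiv.Perm.zpow_apply_eq_self_of_apply_eq_self (by simpa using h) _
  conv_rhs => rw [← Int.emod_add_mul_ediv m n, zpow_add, Equiv.Perm.mul_apply, h1]

theorem IsRegularIET.pow_apply_ne {s : ℕ} {l : ℝ} {len : Fin s → ℝ} {T : Equiv.Perm ℝ}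
    (hreg : IsRegularIET s l len T) {j k : Fin s} (hj : (j : ℕ) ≠ 0) (hk : (k : ℕ) ≠ 0)
    {n : ℕ} (hn : 0 < n) : (T ^ n) (sepPt l len k) ≠ sepPt l len j := by
  intro h
  rcases eq_or_ne k j with rfl | hkj
  · exact hreg.1 k hk (orbitZ_finite_of_periodic hn h)
  · exact disjoint_left.1 (hreg.2 k j hk hj hkj) ⟨n, by simpa using h⟩ ⟨0, by simp⟩

namespace IsIET

variable {s : ℕ} {l r : ℝ} {len : Fin s → ℝ} {π : Equiv.Perm (Fin s)} {T : Equiv.Perm ℝ}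

theorem apply_sepPt (hT : IsIET s l r len π T) (i : Fin s) :
    T (sepPt l len i) = imgPt l len π i := by
  rw [hT.2.2.2.2 i _ ⟨le_rfl, by linarith [hT.2.1 i]⟩]
  ring

theorem sum_symm (hT : IsIET s l r len π T) : ∑ k, len (π.symm k) = r - l := by
  rw [Equiv.sum_comp π.symm len, hT.2.2.1]

theorem apply_mem (hT : IsIET s l r len π T) {x : ℝ} (hx : x ∈ Ico l r) : T x ∈ Ico l r := by
  by_contra h
  rw [T.injective (hT.2.2.2.1 _ h)] at h
  exact h hx

theorem inv_apply_mem (hT : IsIET s l r len π T) {x : ℝ} (hx : x ∈ Ico l r) :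
    T⁻¹ x ∈ Ico l r := by
  by_contra h
  have h1 := hT.2.2.2.1 _ h
  rw [← Equiv.Perm.mul_apply, mul_inv_cancel, Equiv.Perm.one_apply] at h1
  exact h (h1 ▸ hx)

theorem isPiecewiseTranslation (hT : IsIET s l r len π T) (hs : 0 < s) :
    IsPiecewiseTranslation T l r (range (sepPt l len)) :=
  isPiecewiseTranslation_of_translate hs hT.2.1 hT.2.2.1 (fun _ => hT.apply_mem) _ hT.2.2.2.2

theorem isPiecewiseTranslation_inv (hT : IsIET s l r len π T) (hs : 0 < s) :
    IsPiecewiseTranslation T⁻¹ l r (range (imgPt l len π)) := by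
  have hrange : range (imgPt l len π) = range (sepPt l fun k => len (π.symm k)) := by
    rw [← π.surjective.range_comp (sepPt l fun k => len (π.symm k))]
    exact congrArg range (funext (imgPt_eq_sepPt l len π))
  rw [hrange]
  refine isPiecewiseTranslation_of_translate hs (fun k => hT.2.1 _) hT.sum_symm
    (fun _ => hT.inv_apply_mem)
    (fun k => sepPt l len (π.symm k) - imgPt l len π (π.symm k)) fun k z hz => ?_
  have himg : imgPt l len π (π.symm k) = sepPt l (fun k => len (π.symm k)) k := by
    rw [imgPt_eq_sepPt, Equiv.apply_symm_apply]
  rw [← himg] at hz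
  rw [Equiv.Perm.inv_eq_iff_eq, hT.2.2.2.2 (π.symm k)]
  · ring
  · constructor <;> linarith [hz.1, hz.2]

/-- In a regular exchange the left endpoint is the image of a nonzero separation point. -/
theorem exists_apply_sepPt_eq_left (hT : IsIET s l r len π T) (hreg : IsRegularIET s l len T)
    (hs : 2 ≤ s) : ∃ j : Fin s, (j : ℕ) ≠ 0 ∧ T (sepPt l len j) = l := by
  set o : Fin s := ⟨0, by omega⟩ with ho
  set e : Fin s := ⟨1, by omega⟩ with he
  have himg : ∀ k, T (sepPt l len (π.symm k)) = sepPt l (fun k => len (π.symm k)) k := by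
    intro k
    rw [hT.apply_sepPt, imgPt_eq_sepPt, Equiv.apply_symm_apply]
  refine ⟨π.symm o, fun h0 => ?_, by rw [himg, sepPt_zero]⟩
  have hfix : π.symm o = o := Fin.ext h0
  have hne : ((π.symm e : Fin s) : ℕ) ≠ 0 := by
    intro h
    have h1 : π.symm e = π.symm o := by rw [hfix]; exact Fin.ext h
    simpa [ho, he] using π.symm.injective h1
  refine hreg.pow_apply_ne (j := e) (by simp [he]) hne one_pos ?_
  have h1 := sepPt_succ l len o (by simp [ho]; omega)
  have h2 := sepPt_succ l (fun k => len (π.symm k)) o (by simp [ho]; omega)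
  have he' : (⟨(o : ℕ) + 1, by simp [ho]; omega⟩ : Fin s) = e := rfl
  rw [he', sepPt_zero] at h1 h2
  rw [pow_one, himg, h2, h1, hfix]

theorem sepPt_mem (hT : IsIET s l r len π T) (i : Fin s) : sepPt l len i ∈ Ico l r :=
  ⟨le_sepPt hT.2.1 i, by linarith [sepPt_add_len_le hT.2.1 hT.2.2.1 i, hT.2.1 i]⟩

theorem pow_apply_ne_self (hT : IsIET s l r len π T) (hreg : IsRegularIET s l len T)
    (hs : 2 ≤ s) {x : ℝ} (hx : x ∈ Ico l r) {n : ℕ} (hn : 0 < n) : (T ^ n) x ≠ x := by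
  intro h
  obtain ⟨-, ⟨k, rfl⟩, hk⟩ :=
    (hT.isPiecewiseTranslation (by omega)).exists_periodic_mem hx hn h
  by_cases hk0 : (k : ℕ) = 0
  · obtain ⟨j, hj, hjl⟩ := hT.exists_apply_sepPt_eq_left hreg hs
    have hkl : sepPt l len k = l := by
      rw [show k = ⟨0, by omega⟩ from Fin.ext hk0, sepPt_zero]
    refine hreg.pow_apply_ne hj hj hn (T.injective ?_)
    rw [← perm_pow_succ_apply, perm_pow_add_apply, pow_one, hjl, ← hkl, hk]
  · exact hreg.pow_apply_ne hk0 hk0 hn hk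

theorem inv_pow_apply_ne_imgPt (hT : IsIET s l r len π T) (hreg : IsRegularIET s l len T)
    (hs : 2 ≤ s) (b : ℝ) (hb : b ∈ Ioo l r) (m n : ℕ)
    (hn : (T ^ n) b ∈ range (sepPt l len)) : (T⁻¹ ^ m) b ∉ range (imgPt l len π) := by
  rintro ⟨k, hk⟩
  obtain ⟨j, hj⟩ := hn
  obtain ⟨i, hi, hil⟩ := hT.exists_apply_sepPt_eq_left hreg hs
  have hzero : ∀ k : Fin s, (k : ℕ) = 0 → sepPt l len k = l := fun k hk => by
    rw [show k = ⟨0, by omega⟩ from Fin.ext hk, sepPt_zero]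
  have hb1 : b = (T ^ (m + 1)) (sepPt l len k) := by
    rw [inv_pow, ← hT.apply_sepPt, eq_comm, Equiv.Perm.inv_eq_iff_eq] at hk
    rw [hk, perm_pow_add_apply, pow_one]
  obtain ⟨p, k', hp, hk', hbk⟩ : ∃ (p : ℕ) (k' : Fin s), 0 < p ∧ (k' : ℕ) ≠ 0 ∧
      b = (T ^ p) (sepPt l len k') := by
    by_cases hk0 : (k : ℕ) = 0
    · refine ⟨m + 1 + 1, i, by omega, hi, ?_⟩
      rw [perm_pow_add_apply, pow_one, hil, ← hzero k hk0, hb1]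
    · exact ⟨m + 1, k, by omega, hk0, hb1⟩
  by_cases hj0 : (j : ℕ) = 0
  · rcases n with _ | n
    · rw [hzero j hj0] at hj
      exact hb.1.ne (by simpa using hj)
    · rw [hzero j hj0, ← hil, perm_pow_succ_apply, hbk, ← perm_pow_add_apply] at hj
      exact hreg.pow_apply_ne hi hk' (by omega) (T.injective hj).symm
  · rw [hbk, ← perm_pow_add_apply] at hj
    exact hreg.pow_apply_ne hj0 hk' (by omega) hj.symm

theorem rhoPlusPt_mem (hT : IsIET s l r len π T) (hreg : IsRegularIET s l len T) (hs : 2 ≤ s)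
    {u v z : ℝ} (hlu : l ≤ u) (huv : u < v) (hvr : v ≤ r) (hz : z ∈ Ico l r) :
    0 < rhoPlusPt T u v z ∧ (T ^ rhoPlusPt T u v z) z ∈ Ioo u v :=
  Nat.sInf_mem (s := {n : ℕ | 0 < n ∧ (T ^ n) z ∈ Ioo u v})
    ((hT.isPiecewiseTranslation (by omega)).exists_pow_mem_Ioo
      (hT.isPiecewiseTranslation_inv (by omega))
      (fun _ hx _ hn => hT.pow_apply_ne_self hreg hs hx hn)
      (hT.inv_pow_apply_ne_imgPt hreg hs) hlu huv hvr hz)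

theorem sepPt_mem_divPoints (hT : IsIET s l r len π T) (hreg : IsRegularIET s l len T)
    (hs : 2 ≤ s) {u v : ℝ} (hlu : l ≤ u) (huv : u < v) (hvr : v ≤ r) (i : Fin s) :
    sepPt l len i ∈ divPoints s l len T u v := by
  have h := hT.rhoPlusPt_mem hreg hs hlu huv hvr (hT.sepPt_mem i)
  exact mem_iUnion.2 ⟨i, 0, by omega, by omega, by simp⟩

theorem imgPt_mem_divPoints (hT : IsIET s l r len π T) (hreg : IsRegularIET s l len T)
    (hs : 2 ≤ s) {u v : ℝ} (hlu : l ≤ u) (huv : u < v) (hvr : v ≤ r) {i : Fin s}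
    (hi : imgPt l len π i ∉ Ioo u v) : imgPt l len π i ∈ divPoints s l len T u v := by
  obtain ⟨h0, h⟩ := hT.rhoPlusPt_mem hreg hs hlu huv hvr (hT.sepPt_mem i)
  have h1 : rhoPlusPt T u v (sepPt l len i) ≠ 1 := by
    intro h1
    rw [h1, pow_one, hT.apply_sepPt] at h
    exact hi h
  exact mem_iUnion.2 ⟨i, 1, by omega, by omega, by rw [zpow_one, hT.apply_sepPt]⟩

end IsIET

/-- For a regular `s`-interval exchange transformation, each
exchanged semi-interval `I_i = [γ_i, γ_i + λ_i)` and each image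
`J_i = T(I_i) = [δ_i, δ_i + λ_i)` is admissible. -/
theorem exchanged_intervals_admissible (s : ℕ) (hs : 2 ≤ s) (l r : ℝ)
    (len : Fin s → ℝ) (π : Equiv.Perm (Fin s)) (T : Equiv.Perm ℝ)
    (hIET : IsIET s l r len π T) (hreg : IsRegularIET s l len T) :
    ∀ i : Fin s,
      Admissible s l r len T (sepPt l len i) (sepPt l len i + len i) ∧
      Admissible s l r len T (imgPt l len π i) (imgPt l len π i + len i) := by
  have hpos := hIET.2.1
  have hsum := hIET.2.2.1
  intro i
  refine ⟨?_, ?_⟩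
  · have hl : l ≤ sepPt l len i := le_sepPt hpos i
    have hlt : sepPt l len i < sepPt l len i + len i := by linarith [hpos i]
    have hr := sepPt_add_len_le hpos hsum i
    have hdiv := hIET.sepPt_mem_divPoints hreg hs hl hlt hr
    refine ⟨hl, hlt, hr, Or.inl (hdiv i), ?_⟩
    rcases sepPt_add_len_eq hsum i with h | ⟨k, hk⟩
    · exact Or.inr h
    · exact Or.inl (hk ▸ hdiv k)
  · have himg := imgPt_eq_sepPt l len π
    have hpos' : ∀ k, 0 < len (π.symm k) := fun k => hpos _
    have hl : l ≤ imgPt l len π i := himg i ▸ le_sepPt hpos' (π i)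
    have hlt : imgPt l len π i < imgPt l len π i + len i := by linarith [hpos i]
    have hr : imgPt l len π i + len i ≤ r := by
      simpa [himg] using sepPt_add_len_le hpos' hIET.sum_symm (π i)
    have hdiv := fun k => hIET.imgPt_mem_divPoints hreg hs hl hlt hr (i := k)
    refine ⟨hl, hlt, hr, Or.inl (hdiv i fun h => lt_irrefl _ h.1), ?_⟩
    rcases sepPt_add_len_eq hIET.sum_symm (π i) with h | ⟨k, hk⟩
    · exact Or.inr (by simpa [himg] using h)
    · have hk' : imgPt l len π (π.symm k) = imgPt l len π i + len i := by
        simpa [himg] using hk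
      exact Or.inl (hk' ▸ hdiv (π.symm k) fun h => lt_irrefl _ (hk' ▸ h.2))

end
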